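/- Let G₁, G₂, G₃ be finite groups with a group homomorphism ι: G₁×G₂ → G₃, let f₁, f₂ be unitary representations of G₁ on ℂ^{d₁} and of G₂ on ℂ^{d₂}, and let f₃ be a unitary representation of G₃ on ℂ^{d₁}⊗ℂ^{d₂} satisfying f₃(ι(g₁,g₂)) = f₁(g₁)⊗f₂(g₂) for all g₁ ∈ G₁, g₂ ∈ G₂. Let ρ₁ be an invariant state on ℂ^{d₁}, i.e., f₁(g)ρ₁f₁(g)† = ρ₁ for all g ∈ G₁, and let ρ₂ be a state on ℂ^{d₂}. Then the amount of asymmetry activation satisfies D(ρ₁⊗ρ₂ ‖ av_{f₃}[ρ₁⊗ρ₂]) − D(ρ₂ ‖ av_{f₂}[ρ₂]) = D(ρ₁ ⊗ av_{f₂}[ρ₂] ‖ av_{f₃}[ρ₁⊗ρ₂]). -/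

import Mathlib

open scoped ComplexOrder

/-- Matrix logarithm of a Hermitian matrix, computed via the spectral
decomposition with the convention `log 0 := 0` (junk value `0` if the matrix
is not Hermitian). -/
noncomputable def matLog {n : Type*} [Fintype n] [DecidableEq n]
    (A : Matrix n n ℂ) : Matrix n n ℂ :=
  if hA : A.IsHermitian then
    (hA.eigenvectorUnitary : Matrix n n ℂ) *
      Matrix.diagonal (fun i =>
        if hA.eigenvalues i = 0 then (0 : ℂ) else (Real.log (hA.eigenvalues i) : ℂ)) *
      star (hA.eigenvectorUnitary : Matrix n n ℂ)
  else 0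

/-- The von Neumann entropy `S(ρ) = −tr(ρ log ρ)` (with `0 log 0 := 0`). -/
noncomputable def vN {n : Type*} [Fintype n] [DecidableEq n]
    (ρ : Matrix n n ℂ) : ℝ :=
  - ((ρ * matLog ρ).trace).re

/-- The quantum relative entropy `D(ρ‖σ) = tr ρ (log ρ − log σ)`. -/
noncomputable def Drel {n : Type*} [Fintype n] [DecidableEq n]
    (ρ σ : Matrix n n ℂ) : ℝ :=
  ((ρ * (matLog ρ - matLog σ)).trace).re

/-- A state: a positive semidefinite matrix of trace one. -/
def IsState {n : Type*} [Fintype n] (ρ : Matrix n n ℂ) : Prop :=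
  ρ.PosSemidef ∧ ρ.trace = 1

/-- The group-averaged state `av_f[ρ] = |G|⁻¹ Σ_g f(g) ρ f(g)†`. -/
noncomputable def avf {G : Type*} [Group G] [Fintype G] {n : Type*}
    [Fintype n] [DecidableEq n]
    (f : G →* Matrix.unitaryGroup n ℂ) (ρ : Matrix n n ℂ) : Matrix n n ℂ :=
  ((Fintype.card G : ℂ)⁻¹) •
    ∑ g, (f g : Matrix n n ℂ) * ρ * star (f g : Matrix n n ℂ)

open Kronecker

open Matrix

section MatLog

variable {m n : Type*} [Fintype m] [DecidableEq m] [Fintype n] [DecidableEq n]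

/-- The eigenbasis in which a Hermitian matrix is diagonalized does not affect its logarithm. -/
theorem matLog_eq_of_eq_conj_diagonal {A U : Matrix n n ℂ} (hU : U ∈ unitaryGroup n ℂ)
    (d : n → ℝ) (hA : A = U * diagonal (fun i => (d i : ℂ)) * star U) :
    matLog A = U * diagonal (fun i => (Real.log (d i) : ℂ)) * star U := by
  have hherm : A.IsHermitian := by
    rw [hA, star_eq_conjTranspose]
    refine isHermitian_mul_mul_conjTranspose U ?_
    rw [IsHermitian, diagonal_conjTranspose]
    congr 1
    ext i
    simp
  have hspec := hherm.spectral_theorem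
  set V := (hherm.eigenvectorUnitary : Matrix n n ℂ) with hVdef
  have hV : V ∈ unitaryGroup n ℂ := hherm.eigenvectorUnitary.2
  set e := hherm.eigenvalues
  have hspec : A = V * diagonal (fun i => (e i : ℂ)) * star V := hspec
  have hlog : matLog A = V * diagonal (fun i => (Real.log (e i) : ℂ)) * star V := by
    rw [matLog, dif_pos hherm]
    congr 3
    ext i
    split_ifs with h
    · simp [e, h]
    · rfl
  have hUU : star U * U = 1 := mem_unitaryGroup_iff'.mp hU
  have hUU' : U * star U = 1 := mem_unitaryGroup_iff.mp hU
  have hVV : star V * V = 1 := mem_unitaryGroup_iff'.mp hV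
  have hVV' : V * star V = 1 := mem_unitaryGroup_iff.mp hV
  have hW : (star V * U) * diagonal (fun i => (d i : ℂ))
      = diagonal (fun i => (e i : ℂ)) * (star V * U) := by
    calc _ = star V * (U * diagonal (fun i => (d i : ℂ)) * star U) * U := by
          simp only [Matrix.mul_assoc, hUU, Matrix.mul_one]
      _ = star V * (V * diagonal (fun i => (e i : ℂ)) * star V) * U := by rw [← hA, hspec]
      _ = (star V * V) * diagonal (fun i => (e i : ℂ)) * (star V * U) := by
          simp only [Matrix.mul_assoc]
      _ = _ := by rw [hVV, Matrix.one_mul]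
  have hWlog : (star V * U) * diagonal (fun i => (Real.log (d i) : ℂ))
      = diagonal (fun i => (Real.log (e i) : ℂ)) * (star V * U) := by
    ext i j
    have hij := congrFun (congrFun hW i) j
    rw [mul_diagonal, diagonal_mul] at hij ⊢
    rcases eq_or_ne ((star V * U) i j) 0 with h0 | h0
    · simp [h0]
    · rw [mul_comm] at hij
      rw [Complex.ofReal_injective (mul_right_cancel₀ h0 hij), mul_comm]
  rw [hlog]
  calc _ = V * (diagonal (fun i => (Real.log (e i) : ℂ)) * (star V * U)) * star U := by
        simp only [Matrix.mul_assoc, hUU', Matrix.mul_one]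
    _ = (V * star V) * (U * diagonal (fun i => (Real.log (d i) : ℂ)) * star U) := by
        rw [← hWlog]
        simp only [Matrix.mul_assoc]
    _ = _ := by rw [hVV', Matrix.one_mul]

theorem Matrix.IsHermitian.exists_eq_conj_diagonal {A : Matrix n n ℂ} (hA : A.IsHermitian) :
    ∃ U ∈ unitaryGroup n ℂ, ∃ d : n → ℝ, A = U * diagonal (fun i => (d i : ℂ)) * star U :=
  ⟨hA.eigenvectorUnitary, hA.eigenvectorUnitary.2, hA.eigenvalues, hA.spectral_theorem⟩

theorem matLog_unitary_conj {A V : Matrix n n ℂ} (hA : A.IsHermitian)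
    (hV : V ∈ unitaryGroup n ℂ) : matLog (V * A * star V) = V * matLog A * star V := by
  obtain ⟨U, hU, d, h⟩ := hA.exists_eq_conj_diagonal
  rw [matLog_eq_of_eq_conj_diagonal hU d h,
    matLog_eq_of_eq_conj_diagonal (mul_mem hV hU) d
      (by rw [h, star_mul]; simp only [Matrix.mul_assoc]), star_mul]
  simp only [Matrix.mul_assoc]

theorem conj_diagonal_mul_conj_diagonal {W : Matrix n n ℂ} (hW : star W * W = 1) (a b : n → ℂ) :
    (W * diagonal a * star W) * (W * diagonal b * star W)
      = W * diagonal (fun i => a i * b i) * star W := by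
  rw [← diagonal_mul_diagonal]
  calc _ = W * diagonal a * (star W * W) * diagonal b * star W := by
        simp only [Matrix.mul_assoc]
    _ = _ := by rw [hW]; simp only [Matrix.mul_assoc, Matrix.mul_one]

theorem kronecker_mul_matLog_kronecker {A : Matrix m m ℂ} {B : Matrix n n ℂ}
    (hA : A.IsHermitian) (hB : B.IsHermitian) :
    (A ⊗ₖ B) * matLog (A ⊗ₖ B) = (A * matLog A) ⊗ₖ B + A ⊗ₖ (B * matLog B) := by
  obtain ⟨U, hU, d, hd⟩ := hA.exists_eq_conj_diagonal
  obtain ⟨V, hV, e, he⟩ := hB.exists_eq_conj_diagonal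
  have hUU : star U * U = 1 := mem_unitaryGroup_iff'.mp hU
  have hVV : star V * V = 1 := mem_unitaryGroup_iff'.mp hV
  have hstar : star (U ⊗ₖ V) = star U ⊗ₖ star V := conjTranspose_kronecker U V
  have hUV : U ⊗ₖ V ∈ unitaryGroup (m × n) ℂ := kronecker_mem_unitary hU hV
  have hAB : A ⊗ₖ B = (U ⊗ₖ V) * diagonal (fun i => ((d i.1 * e i.2 : ℝ) : ℂ))
      * star (U ⊗ₖ V) := by
    rw [hd, he, mul_kronecker_mul, mul_kronecker_mul, diagonal_kronecker_diagonal, hstar]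
    simp
  rw [matLog_eq_of_eq_conj_diagonal hUV _ hAB, matLog_eq_of_eq_conj_diagonal hU d hd,
    matLog_eq_of_eq_conj_diagonal hV e he, hAB,
    conj_diagonal_mul_conj_diagonal (mem_unitaryGroup_iff'.mp hUV), hd, he,
    conj_diagonal_mul_conj_diagonal hUU, conj_diagonal_mul_conj_diagonal hVV,
    mul_kronecker_mul, mul_kronecker_mul, mul_kronecker_mul,
    mul_kronecker_mul, diagonal_kronecker_diagonal, diagonal_kronecker_diagonal, ← hstar,
    ← Matrix.add_mul, ← Matrix.mul_add, diagonal_add]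
  congr 3
  ext ⟨i, j⟩
  rcases eq_or_ne (d i) 0 with hi | hi
  · simp [hi]
  rcases eq_or_ne (e j) 0 with hj | hj
  · simp [hj]
  rw [Real.log_mul hi hj]
  push_cast
  ring

end MatLog

section Averaging

variable {G : Type*} [Group G] [Fintype G] {n : Type*} [Fintype n] [DecidableEq n]
  (f : G →* unitaryGroup n ℂ)

theorem avf_isHermitian {ρ : Matrix n n ℂ} (hρ : ρ.IsHermitian) : (avf f ρ).IsHermitian := by
  have hsum : (∑ g, (f g : Matrix n n ℂ) * ρ * star (f g : Matrix n n ℂ)).IsHermitian := by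
    rw [IsHermitian, conjTranspose_sum]
    exact Finset.sum_congr rfl fun g _ => isHermitian_mul_mul_conjTranspose _ hρ
  rw [IsHermitian, avf, conjTranspose_smul, hsum.eq]
  simp

theorem conj_avf (ρ : Matrix n n ℂ) (h : G) :
    (f h : Matrix n n ℂ) * avf f ρ * star (f h : Matrix n n ℂ) = avf f ρ := by
  rw [avf, Matrix.mul_smul, Matrix.smul_mul, Matrix.mul_sum, Matrix.sum_mul]
  congr 1
  refine Fintype.sum_equiv (Equiv.mulLeft h) _ _ fun g => ?_
  simp only [Equiv.coe_mulLeft, map_mul, Submonoid.coe_mul, star_mul, Matrix.mul_assoc]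

theorem trace_avf_mul (ρ : Matrix n n ℂ) {X : Matrix n n ℂ}
    (hX : ∀ g, (f g : Matrix n n ℂ) * X * star (f g : Matrix n n ℂ) = X) :
    (avf f ρ * X).trace = (ρ * X).trace := by
  have hterm (g : G) : ((f g : Matrix n n ℂ) * ρ * star (f g : Matrix n n ℂ) * X).trace
      = (ρ * X).trace := by
    have hgg : star (f g : Matrix n n ℂ) * (f g : Matrix n n ℂ) = 1 :=
      mem_unitaryGroup_iff'.mp (f g).2
    calc _ = ((f g : Matrix n n ℂ) * ρ * star (f g : Matrix n n ℂ) *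
          ((f g : Matrix n n ℂ) * X * star (f g : Matrix n n ℂ))).trace := by rw [hX]
      _ = ((f g : Matrix n n ℂ) * (ρ * (star (f g : Matrix n n ℂ) * (f g : Matrix n n ℂ)) * X
          * star (f g : Matrix n n ℂ))).trace := by simp only [Matrix.mul_assoc]
      _ = _ := by rw [hgg, trace_mul_comm, Matrix.mul_assoc, hgg, Matrix.mul_one, Matrix.mul_one]
  rw [avf, Matrix.smul_mul, Matrix.sum_mul, trace_smul, trace_sum]
  simp [hterm]

theorem trace_avf (ρ : Matrix n n ℂ) : (avf f ρ).trace = ρ.trace := by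
  simpa using trace_avf_mul f ρ (X := 1) fun g => by
    rw [Matrix.mul_one]
    exact mem_unitaryGroup_iff.mp (f g).2

theorem conj_matLog_avf {ρ : Matrix n n ℂ} (hρ : ρ.IsHermitian) (h : G) :
    (f h : Matrix n n ℂ) * matLog (avf f ρ) * star (f h : Matrix n n ℂ)
      = matLog (avf f ρ) := by
  rw [← matLog_unitary_conj (avf_isHermitian f hρ) (f h).2, conj_avf]

theorem kronecker_avf {m : Type*} [Fintype m] [DecidableEq m]
    {F : G →* unitaryGroup (m × n) ℂ}
    (hF : ∀ g, (F g : Matrix (m × n) (m × n) ℂ) = 1 ⊗ₖ (f g : Matrix n n ℂ))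
    (A : Matrix m m ℂ) (B : Matrix n n ℂ) : A ⊗ₖ avf f B = avf F (A ⊗ₖ B) := by
  have hsum (M : G → Matrix n n ℂ) : A ⊗ₖ (∑ g, M g) = ∑ g, A ⊗ₖ M g := by
    ext
    simp [kroneckerMap_apply, Matrix.sum_apply, Finset.mul_sum]
  rw [avf, avf, kronecker_smul, hsum]
  congr 1
  refine Finset.sum_congr rfl fun g _ => ?_
  rw [hF, star_eq_conjTranspose (_ ⊗ₖ _), conjTranspose_kronecker, ← mul_kronecker_mul,
    ← mul_kronecker_mul, conjTranspose_one, Matrix.one_mul, Matrix.mul_one,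
    star_eq_conjTranspose]

end Averaging

/-- asymmetry activation identity. If `f₃ ∘ ι = f₁ ⊗ f₂`, `ρ₁` is
`f₁`-invariant and `ρ₂` is a state, then
`D(ρ₁⊗ρ₂ ‖ av_{f₃}[ρ₁⊗ρ₂]) − D(ρ₂ ‖ av_{f₂}[ρ₂]) = D(ρ₁ ⊗ av_{f₂}[ρ₂] ‖ av_{f₃}[ρ₁⊗ρ₂])`. -/
theorem statement_6 {G₁ G₂ G₃ : Type} [Group G₁] [Fintype G₁]
    [Group G₂] [Fintype G₂] [Group G₃] [Fintype G₃]
    (ι : G₁ × G₂ →* G₃) {d₁ d₂ : ℕ}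
    (f₁ : G₁ →* Matrix.unitaryGroup (Fin d₁) ℂ)
    (f₂ : G₂ →* Matrix.unitaryGroup (Fin d₂) ℂ)
    (f₃ : G₃ →* Matrix.unitaryGroup (Fin d₁ × Fin d₂) ℂ)
    (hcomp : ∀ (g₁ : G₁) (g₂ : G₂),
      (f₃ (ι (g₁, g₂)) : Matrix (Fin d₁ × Fin d₂) (Fin d₁ × Fin d₂) ℂ)
        = (f₁ g₁ : Matrix (Fin d₁) (Fin d₁) ℂ) ⊗ₖ (f₂ g₂ : Matrix (Fin d₂) (Fin d₂) ℂ))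
    (ρ₁ : Matrix (Fin d₁) (Fin d₁) ℂ) (hρ₁ : IsState ρ₁)
    (hinv : ∀ g₁ : G₁,
      (f₁ g₁ : Matrix (Fin d₁) (Fin d₁) ℂ) * ρ₁ *
        star (f₁ g₁ : Matrix (Fin d₁) (Fin d₁) ℂ) = ρ₁)
    (ρ₂ : Matrix (Fin d₂) (Fin d₂) ℂ) (hρ₂ : IsState ρ₂) :
    Drel (ρ₁ ⊗ₖ ρ₂) (avf f₃ (ρ₁ ⊗ₖ ρ₂)) - Drel ρ₂ (avf f₂ ρ₂)
      = Drel (ρ₁ ⊗ₖ avf f₂ ρ₂) (avf f₃ (ρ₁ ⊗ₖ ρ₂)) := by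
  have h₁ : ρ₁.IsHermitian := hρ₁.1.isHermitian
  have h₂ : ρ₂.IsHermitian := hρ₂.1.isHermitian
  have h₁₂ : (ρ₁ ⊗ₖ ρ₂).IsHermitian := by
    rw [IsHermitian, conjTranspose_kronecker, h₁.eq, h₂.eq]
  have hσ₂ := avf_isHermitian f₂ h₂
  have hkron := kronecker_avf f₂ (F := f₃.comp (ι.comp (MonoidHom.inr G₁ G₂)))
    (fun g => by simpa using hcomp 1 g) ρ₁ ρ₂
  have hcross : ((ρ₁ ⊗ₖ avf f₂ ρ₂) * matLog (avf f₃ (ρ₁ ⊗ₖ ρ₂))).trace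
      = ((ρ₁ ⊗ₖ ρ₂) * matLog (avf f₃ (ρ₁ ⊗ₖ ρ₂))).trace := by
    rw [hkron]
    exact trace_avf_mul _ _ fun g => conj_matLog_avf f₃ h₁₂ _
  have hlocal : (avf f₂ ρ₂ * matLog (avf f₂ ρ₂)).trace = (ρ₂ * matLog (avf f₂ ρ₂)).trace :=
    trace_avf_mul f₂ ρ₂ (conj_matLog_avf f₂ h₂)
  simp only [Drel, Matrix.mul_sub, trace_sub, hcross, kronecker_mul_matLog_kronecker h₁ h₂,
    kronecker_mul_matLog_kronecker h₁ hσ₂, trace_add, trace_kronecker, trace_avf, hρ₁.2, hρ₂.2,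
    hlocal, mul_one, one_mul, Complex.sub_re, Complex.add_re]
  ring
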